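/- Let (S, d) be a separable complete metric space and suppose that for each n, m the random elements X_{n,m} and X_n are defined on the same probability space with values in S. Assume that for each m, X_{n,m} converges in distribution to Y_m as n → ∞, and that for every ε > 0, lim_{m→∞} limsup_{n→∞} P(d(X_{n,m}, X_n) ≥ ε) = 0. Then there exists an S-valued random element X (equivalently, a Borel probability measure on S) such that Y_m converges in distribution to X as m → ∞ and X_n converges in distribution to X as n → ∞. -/

import Mathlib

open MeasureTheory Filter
open scoped ENNReal Topology

noncomputable section

/-- Weak convergence of a sequence of laws on a metric space `S`, expressed by integrals
of bounded continuous functions. -/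
def WeakTendstoM {S : Type*} [MetricSpace S] [MeasurableSpace S]
    (μ : ℕ → Measure S) (ν : Measure S) : Prop :=
  ∀ g : BoundedContinuousFunction S ℝ,
    Tendsto (fun n => ∫ x, g x ∂(μ n)) atTop (𝓝 (∫ x, g x ∂ν))

open Metric in
/-- A criterion for tightness in a complete metric space. -/
lemma isTightMeasureSet_of_forall_exists_isCompact_cthickening {E : Type*} [PseudoMetricSpace E]
    [CompleteSpace E] [MeasurableSpace E] {T : Set (Measure E)}
    (h : ∀ ε : ℝ, 0 < ε → ∃ K : Set E, IsCompact K ∧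
      ∀ μ ∈ T, μ (cthickening ε K)ᶜ ≤ ENNReal.ofReal ε) :
    IsTightMeasureSet T := by
  rw [isTightMeasureSet_iff_exists_isCompact_measure_compl_le]
  intro ε hε
  obtain ⟨δ, δ_pos, hδ⟩ := ENNReal.exists_pos_sum_of_countable hε.ne' ℕ
  have η_pos (j : ℕ) : 0 < min (δ j : ℝ) (1 / (j + 1)) :=
    lt_min (δ_pos j) Nat.one_div_pos_of_nat
  choose K hK hKT using fun j => h _ (η_pos j)
  refine ⟨⋂ j, cthickening (min (δ j : ℝ) (1 / (j + 1))) (K j), ?_, fun μ hμ => ?_⟩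
  · refine TotallyBounded.isCompact_of_isClosed ?_ (isClosed_iInter fun j => isClosed_cthickening)
    refine Metric.totallyBounded_iff.2 fun r hr => ?_
    obtain ⟨j, hj⟩ := exists_nat_one_div_lt (half_pos hr)
    obtain ⟨t, t_fin, ht⟩ := Metric.totallyBounded_iff.1 (hK j).totallyBounded (r / 2) (half_pos hr)
    refine ⟨t, t_fin, fun x hx => ?_⟩
    have hx' : x ∈ thickening (r / 2) (K j) :=
      cthickening_subset_thickening' (half_pos hr) ((min_le_right _ _).trans_lt hj) _
        (Set.mem_iInter.1 hx j)
    obtain ⟨y, hy, hxy⟩ := mem_thickening_iff.1 hx'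
    obtain ⟨z, hz, hyz⟩ := Set.mem_iUnion₂.1 (ht hy)
    refine Set.mem_iUnion₂.2 ⟨z, hz, ?_⟩
    rw [mem_ball] at hyz ⊢
    linarith [dist_triangle x y z]
  · rw [Set.compl_iInter]
    refine (measure_iUnion_le _).trans (le_trans (ENNReal.tsum_le_tsum fun j => ?_) hδ.le)
    refine (hKT j μ hμ).trans ((ENNReal.ofReal_le_ofReal (min_le_left _ _)).trans ?_)
    simp

open Metric in
/-- A Lévy-Prokhorov Cauchy sequence of probability measures on a complete separable metric space
is tight. -/
lemma isTightMeasureSet_of_cauchySeq_levyProkhorov {E : Type*} [MetricSpace E] [CompleteSpace E]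
    [SecondCountableTopology E] [MeasurableSpace E] [BorelSpace E]
    {u : ℕ → LevyProkhorov (ProbabilityMeasure E)} (hu : CauchySeq u) :
    IsTightMeasureSet (Set.range fun n => ((u n).toMeasure : Measure E)) := by
  refine isTightMeasureSet_of_forall_exists_isCompact_cthickening fun ε hε => ?_
  have hε2 : 0 < ENNReal.ofReal (ε / 2) := ENNReal.ofReal_pos.2 (half_pos hε)
  obtain ⟨N, hN⟩ := EMetric.cauchySeq_iff'.1 hu _ hε2
  have hK (n : ℕ) : ∃ K : Set E, IsCompact K ∧
      ((u n).toMeasure : Measure E) Kᶜ ≤ ENNReal.ofReal (ε / 2) := by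
    obtain ⟨K, hK, h⟩ := isTightMeasureSet_iff_exists_isCompact_measure_compl_le.1
      (isTightMeasureSet_singleton (μ := ((u n).toMeasure : Measure E))) _ hε2
    exact ⟨K, hK, h _ rfl⟩
  choose K hK hKu using hK
  have K_subset {n : ℕ} (hn : n ≤ N) : K n ⊆ ⋃ i ∈ Set.Iic N, K i :=
    Set.subset_biUnion_of_mem (u := K) (Set.mem_Iic.2 hn)
  refine ⟨⋃ n ∈ Set.Iic N, K n, (Set.finite_Iic N).isCompact_biUnion fun i _ => hK i, ?_⟩
  rintro _ ⟨n, rfl⟩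
  rcases le_total n N with hn | hn
  · calc ((u n).toMeasure : Measure E) (cthickening ε (⋃ n ∈ Set.Iic N, K n))ᶜ
      _ ≤ ((u n).toMeasure : Measure E) (K n)ᶜ :=
        measure_mono (Set.compl_subset_compl.2
          ((K_subset hn).trans (self_subset_cthickening _)))
      _ ≤ ENNReal.ofReal (ε / 2) := hKu n
      _ ≤ ENNReal.ofReal ε := ENNReal.ofReal_le_ofReal (half_le_self hε.le)
  · have hlt : levyProkhorovEDist ((u n).toMeasure : Measure E) ((u N).toMeasure : Measure E)
        < ENNReal.ofReal (ε / 2) := hN n hn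
    calc ((u n).toMeasure : Measure E) (cthickening ε (⋃ n ∈ Set.Iic N, K n))ᶜ
      _ ≤ ((u N).toMeasure : Measure E)
            (thickening (ε / 2) (cthickening ε (⋃ n ∈ Set.Iic N, K n))ᶜ)
          + ENNReal.ofReal (ε / 2) := by
        simpa only [ENNReal.toReal_ofReal (half_pos hε).le] using
          left_measure_le_of_levyProkhorovEDist_lt hlt
            isClosed_cthickening.measurableSet.compl
      _ ≤ ((u N).toMeasure : Measure E) (K N)ᶜ + ENNReal.ofReal (ε / 2) := by
        gcongr
        intro x hx hxK
        obtain ⟨y, hy, hxy⟩ := mem_thickening_iff.1 hx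
        refine hy (thickening_subset_cthickening _ _
          (mem_thickening_iff.2 ⟨x, K_subset le_rfl hxK, ?_⟩))
        rw [dist_comm]
        linarith
      _ ≤ ENNReal.ofReal (ε / 2) + ENNReal.ofReal (ε / 2) := by
        gcongr
        exact hKu N
      _ = ENNReal.ofReal ε := by
        rw [← ENNReal.ofReal_add (half_pos hε).le (half_pos hε).le, add_halves]

/-- The Lévy-Prokhorov metric on probability measures on a complete separable metric space is
complete. -/
lemma completeSpace_levyProkhorov_probabilityMeasure {E : Type*} [MetricSpace E] [CompleteSpace E]
    [SecondCountableTopology E] [MeasurableSpace E] [BorelSpace E] :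
    CompleteSpace (LevyProkhorov (ProbabilityMeasure E)) := by
  refine Metric.complete_of_cauchySeq_tendsto fun u hu => ?_
  have hT : IsTightMeasureSet {((μ : ProbabilityMeasure E) : Measure E) |
      μ ∈ Set.range fun n => (u n).toMeasure} := by
    refine (isTightMeasureSet_of_cauchySeq_levyProkhorov hu).subset ?_
    rintro _ ⟨_, ⟨n, rfl⟩, rfl⟩
    exact ⟨n, rfl⟩
  obtain ⟨μ, -, φ, hφ, hμ⟩ := (isCompact_closure_of_isTightMeasureSet hT).isSeqCompact
    (x := fun n => (u n).toMeasure) fun n => subset_closure ⟨n, rfl⟩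
  refine ⟨LevyProkhorov.ofMeasure μ, tendsto_nhds_of_cauchySeq_of_subseq hu hφ.tendsto_atTop ?_⟩
  exact (LevyProkhorov.continuous_ofMeasure_probabilityMeasure.tendsto μ).comp hμ

open Metric in
/-- The Lévy-Prokhorov distance of two laws is bounded by the Ky Fan distance of the variables. -/
lemma levyProkhorovDist_map_le {Ω E : Type*} [MeasurableSpace Ω] [PseudoMetricSpace E]
    [MeasurableSpace E] [OpensMeasurableSpace E] {P : Measure Ω} [IsProbabilityMeasure P]
    {f g : Ω → E} (hf : Measurable f) (hg : Measurable g) {ε : ℝ} (hε : 0 ≤ ε)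
    (h : P {ω | ε ≤ dist (f ω) (g ω)} ≤ ENNReal.ofReal ε) :
    levyProkhorovDist (P.map f) (P.map g) ≤ ε := by
  have := Measure.isProbabilityMeasure_map (μ := P) hf.aemeasurable
  have := Measure.isProbabilityMeasure_map (μ := P) hg.aemeasurable
  refine levyProkhorovDist_le_of_forall_le _ _ hε fun δ B hδ hB => ?_
  rw [Measure.map_apply hf hB, Measure.map_apply hg isOpen_thickening.measurableSet]
  calc P (f ⁻¹' B) ≤ P (g ⁻¹' thickening δ B ∪ {ω | ε ≤ dist (f ω) (g ω)}) := by
        refine measure_mono fun ω hω => or_iff_not_imp_right.2 fun hd => ?_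
        refine mem_thickening_iff.2 ⟨f ω, hω, ?_⟩
        rw [dist_comm]
        exact (not_le.1 hd).trans hδ
    _ ≤ P (g ⁻¹' thickening δ B) + P {ω | ε ≤ dist (f ω) (g ω)} := measure_union_le _ _
    _ ≤ P (g ⁻¹' thickening δ B) + ENNReal.ofReal δ := by
        gcongr
        exact h.trans (ENNReal.ofReal_le_ofReal hδ.le)

lemma exists_tendsto_of_forall_eventually_eventually_dist_lt {E : Type*} [PseudoMetricSpace E]
    [CompleteSpace E] {a b : ℕ → E}
    (h : ∀ ε : ℝ, 0 < ε → ∀ᶠ m in atTop, ∀ᶠ n in atTop, dist (a m) (b n) < ε) :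
    ∃ x, Tendsto a atTop (𝓝 x) ∧ Tendsto b atTop (𝓝 x) := by
  have ha : CauchySeq a := by
    refine Metric.cauchySeq_iff.2 fun ε hε => ?_
    obtain ⟨M, hM⟩ := eventually_atTop.1 (h (ε / 2) (half_pos hε))
    refine ⟨M, fun k hk l hl => ?_⟩
    obtain ⟨n, hkn, hln⟩ := ((hM k hk).and (hM l hl)).exists
    linarith [dist_triangle_right (a k) (a l) (b n)]
  obtain ⟨x, hx⟩ := cauchySeq_tendsto_of_complete ha
  refine ⟨x, hx, Metric.tendsto_nhds.2 fun ε hε => ?_⟩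
  obtain ⟨m, hm, hmx⟩ :=
    ((h (ε / 2) (half_pos hε)).and (Metric.tendsto_nhds.1 hx (ε / 2) (half_pos hε))).exists
  filter_upwards [hm] with n hn
  linarith [dist_triangle_left (b n) x (a m)]

lemma tendsto_levyProkhorov_iff_weakTendstoM {E : Type*} [MetricSpace E]
    [SecondCountableTopology E] [MeasurableSpace E] [BorelSpace E]
    {μ : ℕ → ProbabilityMeasure E} {ν : ProbabilityMeasure E} :
    Tendsto (fun n => LevyProkhorov.ofMeasure (μ n)) atTop (𝓝 (LevyProkhorov.ofMeasure ν)) ↔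
      WeakTendstoM (fun n => (μ n : Measure E)) ν := by
  rw [WeakTendstoM, ← ProbabilityMeasure.tendsto_iff_forall_integral_tendsto]
  exact (LevyProkhorov.probabilityMeasureHomeomorph (Ω := E)).isInducing.tendsto_nhds_iff.symm

/-- Lemma 8 of the paper; Theorem 2 in Dehling et al. 2009. On a
separable complete metric space, if `X_{n,m} ⇒_n Y_m` for every `m` and
`lim_m limsup_n P(d(X_{n,m}, X_n) ≥ ε) = 0` for every `ε > 0`, then there is a Borel
probability measure `ν` on `S` (the law of a random element `X`) such that
`Y_m ⇒ ν` and `X_n ⇒ ν`. -/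
theorem stmt7
    {S : Type*} [MetricSpace S] [CompleteSpace S] [TopologicalSpace.SeparableSpace S]
    [MeasurableSpace S] [BorelSpace S]
    {Ω : Type*} [MeasurableSpace Ω] (P : Measure Ω) [IsProbabilityMeasure P]
    (X : ℕ → ℕ → Ω → S) (Xlim : ℕ → Ω → S)
    (hX : ∀ n m, Measurable (X n m)) (hXlim : ∀ n, Measurable (Xlim n))
    (ν : ℕ → Measure S) [∀ m, IsProbabilityMeasure (ν m)]
    (h1 : ∀ m : ℕ, WeakTendstoM (fun n => P.map (X n m)) (ν m))
    (h2 : ∀ ε : ℝ, 0 < ε →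
      Tendsto
        (fun m : ℕ => Filter.limsup
          (fun n : ℕ => P {ω | ε ≤ dist (X n m ω) (Xlim n ω)}) atTop)
        atTop (𝓝 (0 : ℝ≥0∞))) :
    ∃ νlim : Measure S, IsProbabilityMeasure νlim ∧
      WeakTendstoM ν νlim ∧
      WeakTendstoM (fun n => P.map (Xlim n)) νlim := by
  have : SecondCountableTopology S := UniformSpace.secondCountable_of_separable S
  have := completeSpace_levyProkhorov_probabilityMeasure (E := S)
  let law (n m : ℕ) : ProbabilityMeasure S :=
    ⟨P.map (X n m), Measure.isProbabilityMeasure_map (hX n m).aemeasurable⟩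
  let lawLim (n : ℕ) : ProbabilityMeasure S :=
    ⟨P.map (Xlim n), Measure.isProbabilityMeasure_map (hXlim n).aemeasurable⟩
  let ν' (m : ℕ) : ProbabilityMeasure S := ⟨ν m, inferInstance⟩
  obtain ⟨⟨μ⟩, hν, hL⟩ := exists_tendsto_of_forall_eventually_eventually_dist_lt
    (a := fun m => LevyProkhorov.ofMeasure (ν' m))
    (b := fun n => LevyProkhorov.ofMeasure (lawLim n)) fun ε hε => by
      have hε2 := half_pos hε
      filter_upwards [(h2 (ε / 2) hε2).eventually_lt_const (ENNReal.ofReal_pos.2 hε2)] with m hm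
      have hlaw : Tendsto (fun n => LevyProkhorov.ofMeasure (law n m)) atTop
          (𝓝 (LevyProkhorov.ofMeasure (ν' m))) :=
        tendsto_levyProkhorov_iff_weakTendstoM.2 (h1 m)
      filter_upwards [eventually_lt_of_limsup_lt hm, Metric.tendsto_nhds.1 hlaw (ε / 2) hε2]
        with n hn hn'
      have hle : dist (LevyProkhorov.ofMeasure (law n m)) (LevyProkhorov.ofMeasure (lawLim n))
          ≤ ε / 2 := levyProkhorovDist_map_le (hX n m) (hXlim n) hε2.le hn.le
      linarith [dist_triangle_left (LevyProkhorov.ofMeasure (ν' m))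
        (LevyProkhorov.ofMeasure (lawLim n)) (LevyProkhorov.ofMeasure (law n m))]
  exact ⟨μ, inferInstance, tendsto_levyProkhorov_iff_weakTendstoM.1 hν,
    tendsto_levyProkhorov_iff_weakTendstoM.1 hL⟩

end
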